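/- Let q ≥ 2 be an integer and let 0 < a < 1/√(q−1). The operator T_{a,q} on ℓ²(V𝔾^q) with matrix entries (T_{a,q})_{xy} = a^{d(x,y)}, where d is the graph distance on the homogeneous Cayley tree 𝔾^q of degree q, is a bounded self-adjoint operator and ‖T_{a,q}‖ = (1 − a²)/(1 − a√(q−1))². -/

import Mathlib

open Filter MeasureTheory Set
open scoped Topology Classical ENNReal

noncomputable section

/-- The Hilbert space ℓ²(V) with complex coefficients. -/
abbrev L2 (V : Type) := lp (fun _ : V => ℂ) 2

/-- The coordinate (delta) vector at a vertex `x`. -/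
def delta {V : Type} (x : V) : L2 V :=
  haveI := Classical.decEq V; lp.single 2 x 1

/-- The matrix entry `B_{x y} = (B δ_y)(x)` of a bounded operator on ℓ²(V). -/
def entry {V : Type} (B : L2 V →L[ℂ] L2 V) (x y : V) : ℂ :=
  (B (delta y) : ∀ _ : V, ℂ) x

/-- The resolvent `R_B(z) = (z·1 − B)⁻¹` (junk value if not invertible). -/
def Res {V : Type} (B : L2 V →L[ℂ] L2 V) (z : ℂ) : L2 V →L[ℂ] L2 V :=
  Ring.inverse (z • (1 : L2 V →L[ℂ] L2 V) - B)

/-- The resolvent at a real point. -/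
def ResR {V : Type} (B : L2 V →L[ℂ] L2 V) (l : ℝ) : L2 V →L[ℂ] L2 V :=
  Res B (l : ℂ)

/-- `G` is the homogeneous Cayley tree of degree `Q`: connected, acyclic,
and every vertex has exactly `Q` neighbours. -/
structure IsCayleyTree {V : Type} (G : SimpleGraph V) (Q : ℕ) : Prop where
  conn : G.Connected
  acyc : G.IsAcyclic
  deg : ∀ v : V, (G.neighborSet v).ncard = Q

/-- `A` is the adjacency operator of the simple graph `G` on ℓ²(V). -/
def IsAdjacencyOp {V : Type} (G : SimpleGraph V) (A : L2 V →L[ℂ] L2 V) : Prop :=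
  ∀ x y : V, entry A x y = if G.Adj x y then 1 else 0

/-- `P` assigns to each subset `S ⊆ V` the orthogonal projection of ℓ²(V) onto ℓ²(S). -/
def IsProjFamily {V : Type} (P : Set V → (L2 V →L[ℂ] L2 V)) : Prop :=
  ∀ (S : Set V) (f : L2 V) (x : V),
    (P S f : ∀ _ : V, ℂ) x = if x ∈ S then (f : ∀ _ : V, ℂ) x else 0

/-- `S` is the vertex set of a connected subtree of `G` in which every vertex has
exactly `q` neighbours within `S` (a subtree of constant internal degree `q`). -/
def IsRegularSubtree {V : Type} (G : SimpleGraph V) (S : Set V) (q : ℕ) : Prop :=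
  (G.induce S).Connected ∧ ∀ x ∈ S, {y : V | y ∈ S ∧ G.Adj x y}.ncard = q

/-- Distance from a vertex to a set of vertices. -/
def distToSet {V : Type} (G : SimpleGraph V) (x : V) (S : Set V) : ℕ :=
  sInf {n : ℕ | ∃ y ∈ S, G.dist x y = n}

/-- `a(λ)` of equation (4.2) of the paper, for the tree of degree `Q`. -/
def aF (Q : ℕ) (l : ℝ) : ℝ :=
  l * (1 - Real.sqrt (1 - 4 * ((Q : ℝ) - 1) / l ^ 2)) / (2 * ((Q : ℝ) - 1))

/-- `μ(λ)` of equation (4.3) of the paper, for the tree of degree `Q`. -/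
def muF (Q : ℕ) (l : ℝ) : ℝ :=
  l * (((Q : ℝ) - 2) + (Q : ℝ) * Real.sqrt (1 - 4 * ((Q : ℝ) - 1) / l ^ 2)) /
    (2 * ((Q : ℝ) - 1))

/-- `M` realizes the inverse, within the corner algebra `P·B(ℓ²)·P`, of the operator
`P − P T P` (that is, of `I_{ℓ²(S)} − S(λ)` when `T` is the resolvent and `P = P_{ℓ²(S)}`). -/
def IsCornerInverse {V : Type} (P M T : L2 V →L[ℂ] L2 V) : Prop :=
  P ∘L M = M ∧ M ∘L P = M ∧
    M ∘L (P - P ∘L T ∘L P) = P ∧ (P - P ∘L T ∘L P) ∘L M = P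

section EllTwo

variable {V : Type}

theorem L2.hasSum_norm_sq (f : L2 V) : HasSum (fun x => ‖f x‖ ^ 2) (‖f‖ ^ 2) := by
  simpa using lp.hasSum_norm (p := 2) (by simp) f

theorem memℓp_two_of_summable {f : V → ℂ} (hf : Summable fun x => ‖f x‖ ^ 2) :
    Memℓp (E := fun _ : V => ℂ) f 2 :=
  memℓp_gen (by simpa using hf)

theorem delta_apply (y x : V) : delta y x = if x = y then (1 : ℂ) else 0 := by
  unfold delta
  by_cases h : x = y
  · subst h
    simp
  · rw [lp.single_apply_ne _ _ _ h, if_neg h]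

theorem ext_entry {S T : L2 V →L[ℂ] L2 V} (h : ∀ x y, entry S x y = entry T x y) : S = T := by
  refine lp.ext_continuousLinearMap (by simp) fun y => ?_
  have hy : S (delta y) = T (delta y) := by
    ext x
    exact h x y
  ext
  unfold delta at hy
  simp [hy]

theorem entry_adjoint (T : L2 V →L[ℂ] L2 V) (x y : V) :
    entry (ContinuousLinearMap.adjoint T) x y = starRingEnd ℂ (entry T y x) := by
  have hinner (z : V) (f : L2 V) : inner ℂ (delta z) f = f z := by
    unfold delta
    rw [lp.inner_single_left]
    simp
  unfold entry
  rw [← hinner, ContinuousLinearMap.adjoint_inner_right, ← hinner, inner_conj_symm]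

end EllTwo

section Tree

variable {V : Type} {G : SimpleGraph V}

/-- In a tree rooted at `y`, every vertex other than the root has one neighbour (its parent)
closer to the root, and all its other neighbours are further away. -/
theorem SimpleGraph.IsTree.exists_parent (hG : G.IsTree) {y x : V} (hxy : x ≠ y) :
    ∃ p, G.Adj x p ∧ G.dist y x = G.dist y p + 1 ∧
      ∀ z, G.Adj x z → z ≠ p → G.dist y z = G.dist y x + 1 := by
  obtain ⟨w, hw, hwl⟩ := hG.connected.exists_path_of_dist y x
  have hnil : ¬ w.Nil := w.not_nil_of_ne hxy.symm
  have key : ∀ z, G.Adj x z → z ≠ w.penultimate → G.dist y z = G.dist y x + 1 := by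
    intro z hz hne
    refine (hG.dist_eq_dist_add_one_of_adj y hz).resolve_left fun h => hne ?_
    obtain ⟨v, hv⟩ := hG.connected.exists_walk_length_eq_dist y z
    have hp : (v.concat hz.symm).IsPath :=
      SimpleGraph.Walk.isPath_of_length_eq_dist _ (by simp [hv, h])
    have := (hG.isAcyclic.subsingleton_path y x).elim ⟨_, hp⟩ ⟨w, hw⟩
    rw [← congrArg (fun p : G.Path y x => (p : G.Walk y x).penultimate) this]
    simp
  refine ⟨w.penultimate, (w.adj_penultimate hnil).symm, ?_, key⟩
  refine (hG.dist_eq_dist_add_one_of_adj y (w.adj_penultimate hnil).symm).resolve_right fun h => ?_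
  have := G.dist_le w.dropLast
  have := w.length_dropLast_add_one hnil
  omega

variable [G.LocallyFinite]

theorem SimpleGraph.IsTree.sum_neighborFinset_dist {M : Type*} [AddCommMonoid M] (hG : G.IsTree)
    {m n : ℕ} (hreg : G.IsRegularOfDegree (m + 1)) {y x : V} (hn : G.dist y x = n + 1)
    (φ : ℕ → M) :
    ∑ z ∈ G.neighborFinset x, φ (G.dist y z) = φ n + m • φ (n + 2) := by
  have hxy : x ≠ y := by rintro rfl; simp at hn
  obtain ⟨p, hp, hd, h⟩ := hG.exists_parent hxy
  have hmem : p ∈ G.neighborFinset x := by simpa using hp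
  rw [← Finset.add_sum_erase _ _ hmem, show G.dist y p = n by omega]
  congr 1
  rw [Finset.sum_congr rfl (g := fun _ => φ (n + 2)), Finset.sum_const,
    Finset.card_erase_of_mem hmem, G.card_neighborFinset_eq_degree, hreg x, Nat.add_sub_cancel]
  intro z hz
  rw [Finset.mem_erase, SimpleGraph.mem_neighborFinset] at hz
  rw [h z hz.2 hz.1, hn]

theorem SimpleGraph.sum_neighborFinset_dist_self {M : Type*} [AddCommMonoid M] {d : ℕ}
    (hreg : G.IsRegularOfDegree d) (y : V) (φ : ℕ → M) :
    ∑ z ∈ G.neighborFinset y, φ (G.dist y z) = d • φ 1 := by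
  rw [Finset.sum_congr rfl (g := fun _ => φ 1), Finset.sum_const,
    G.card_neighborFinset_eq_degree, hreg y]
  intro z hz
  rw [SimpleGraph.mem_neighborFinset] at hz
  rw [SimpleGraph.dist_eq_one_iff_adj.2 hz]

theorem SimpleGraph.tsum_mul_sum_neighborFinset (F H : V → ℝ≥0∞) :
    ∑' x, F x * ∑ z ∈ G.neighborFinset x, H z = ∑' x, (∑ z ∈ G.neighborFinset x, F z) * H x := by
  have hsum : ∀ (K : V → ℝ≥0∞) (x : V),
      ∑ z ∈ G.neighborFinset x, K z = ∑' z, if G.Adj x z then K z else 0 := by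
    intro K x
    rw [tsum_eq_sum (s := G.neighborFinset x)]
    · refine Finset.sum_congr rfl fun z hz => ?_
      rw [SimpleGraph.mem_neighborFinset] at hz
      rw [if_pos hz]
    · intro z hz
      rw [SimpleGraph.mem_neighborFinset] at hz
      rw [if_neg hz]
  simp_rw [hsum, ← ENNReal.tsum_mul_left, ← ENNReal.tsum_mul_right]
  rw [ENNReal.tsum_comm]
  refine tsum_congr fun z => tsum_congr fun x => ?_
  simp [G.adj_comm x z]

theorem SimpleGraph.IsTree.tsum_sphere_succ (hG : G.IsTree) {m : ℕ}
    (hreg : G.IsRegularOfDegree (m + 1)) (y : V) (n : ℕ) :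
    ∑' x, (if G.dist y x = n + 1 then (1 : ℝ≥0∞) else 0) = (m + 1) * m ^ n := by
  have hswap (n : ℕ) := G.tsum_mul_sum_neighborFinset
    (fun x => if G.dist y x = n then (1 : ℝ≥0∞) else 0)
    (fun x => if G.dist y x = n + 1 then (1 : ℝ≥0∞) else 0)
  have hright (n : ℕ) : ∑' x, (∑ z ∈ G.neighborFinset x,
      if G.dist y z = n then (1 : ℝ≥0∞) else 0) * (if G.dist y x = n + 1 then (1 : ℝ≥0∞) else 0)
      = ∑' x, (if G.dist y x = n + 1 then (1 : ℝ≥0∞) else 0) := by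
    refine tsum_congr fun x => ?_
    split_ifs with h
    · rw [hG.sum_neighborFinset_dist hreg h (fun k => if k = n then (1 : ℝ≥0∞) else 0)]
      simp
    · simp
  rw [← hright, ← hswap]
  induction n with
  | zero =>
    rw [tsum_eq_single y]
    · rw [G.sum_neighborFinset_dist_self hreg y (fun k => if k = 0 + 1 then (1 : ℝ≥0∞) else 0)]
      simp
    · intro x hx
      rw [if_neg, zero_mul]
      exact (hG.connected.pos_dist_of_ne hx.symm).ne'
  | succ n ih =>
    rw [hswap, hright] at ih
    rw [pow_succ, ← mul_assoc, ← ih, ← ENNReal.tsum_mul_right]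
    refine tsum_congr fun x => ?_
    split_ifs with h
    · rw [hG.sum_neighborFinset_dist hreg h (fun k => if k = n + 1 + 1 then (1 : ℝ≥0∞) else 0)]
      simp [show n ≠ n + 1 + 1 by omega]
    · simp

theorem SimpleGraph.IsTree.tsum_pow_dist (hG : G.IsTree) {m : ℕ}
    (hreg : G.IsRegularOfDegree (m + 1)) (y : V) (r : ℝ≥0∞) :
    ∑' x, r ^ G.dist y x = 1 + (m + 1) * r * (1 - m * r)⁻¹ := by
  have hfib (x : V) : r ^ G.dist y x =
      ∑' n, r ^ n * (if G.dist y x = n then (1 : ℝ≥0∞) else 0) := by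
    rw [tsum_eq_single (G.dist y x)]
    · simp
    · intro n hn
      simp [hn.symm]
  simp_rw [hfib]
  rw [ENNReal.tsum_comm]
  simp_rw [ENNReal.tsum_mul_left]
  rw [tsum_eq_zero_add' ENNReal.summable]
  simp_rw [hG.tsum_sphere_succ hreg]
  congr 1
  · rw [tsum_eq_single y]
    · simp
    · intro x hx
      rw [if_neg (hG.connected.pos_dist_of_ne hx.symm).ne']
  · rw [← ENNReal.tsum_geometric, ← ENNReal.tsum_mul_left]
    refine tsum_congr fun n => ?_
    ring

theorem SimpleGraph.IsTree.hasSum_pow_dist (hG : G.IsTree) {m : ℕ}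
    (hreg : G.IsRegularOfDegree (m + 1)) (y : V) {r : ℝ} (hr0 : 0 ≤ r) (hr1 : m * r < 1) :
    HasSum (fun x => r ^ G.dist y x) ((1 + r) / (1 - m * r)) := by
  have hnn : 0 ≤ (1 + r) / (1 - m * r) := div_nonneg (by positivity) (by linarith)
  have h := hG.tsum_pow_dist hreg y (ENNReal.ofReal r)
  have hval : 1 + (m + 1) * ENNReal.ofReal r * (1 - m * ENNReal.ofReal r)⁻¹
      = ENNReal.ofReal ((1 + r) / (1 - m * r)) := by
    rw [← ENNReal.ofReal_natCast m, ← ENNReal.ofReal_one, ← ENNReal.ofReal_mul (by positivity),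
      ← ENNReal.ofReal_sub _ (by positivity), ← ENNReal.ofReal_inv_of_pos (by linarith),
      ← ENNReal.ofReal_add (by positivity) (by positivity), ← ENNReal.ofReal_mul (by positivity),
      ← ENNReal.ofReal_mul (by positivity), ← ENNReal.ofReal_add (by positivity)
        (mul_nonneg (by positivity) (inv_nonneg.2 (by linarith)))]
    congr 1
    have : (1 : ℝ) - m * r ≠ 0 := by linarith
    field_simp
    ring
  rw [hval] at h
  simp_rw [← ENNReal.ofReal_pow hr0] at h
  have hsum : Summable fun x => r ^ G.dist y x := by
    have := ENNReal.summable_toReal (h.trans_ne ENNReal.ofReal_ne_top)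
    simpa [ENNReal.toReal_ofReal (pow_nonneg hr0 _)] using this
  rw [← ENNReal.ofReal_tsum_of_nonneg (fun x => pow_nonneg hr0 _) hsum] at h
  have := (ENNReal.ofReal_eq_ofReal_iff (tsum_nonneg fun x => pow_nonneg hr0 _) hnn).1 h
  exact this ▸ hsum.hasSum


theorem SimpleGraph.tsum_norm_sum_neighborFinset_sq_le {h : V → ℝ} (hpos : ∀ x, 0 < h x) {L : ℝ}
    (hL : ∀ x, ∑ z ∈ G.neighborFinset x, h z ≤ L * h x) (f : V → ℂ) :
    ∑' x, ENNReal.ofReal (‖∑ z ∈ G.neighborFinset x, f z‖ ^ 2) ≤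
      ENNReal.ofReal (L ^ 2) * ∑' x, ENNReal.ofReal (‖f x‖ ^ 2) := by
  have hnonneg : ∀ x, 0 ≤ L * h x := fun x =>
    (Finset.sum_nonneg fun z _ => (hpos z).le).trans (hL x)
  calc ∑' x, ENNReal.ofReal (‖∑ z ∈ G.neighborFinset x, f z‖ ^ 2)
      ≤ ∑' x, ENNReal.ofReal (L * h x) *
          ∑ z ∈ G.neighborFinset x, ENNReal.ofReal (‖f z‖ ^ 2 / h z) := by
        refine ENNReal.tsum_le_tsum fun x => ?_
        have hdiv : ∀ z, 0 ≤ ‖f z‖ ^ 2 / h z := fun z => div_nonneg (by positivity) (hpos z).le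
        rw [← ENNReal.ofReal_sum_of_nonneg fun z _ => hdiv z, ← ENNReal.ofReal_mul (hnonneg x)]
        refine ENNReal.ofReal_le_ofReal ?_
        calc ‖∑ z ∈ G.neighborFinset x, f z‖ ^ 2
            ≤ (∑ z ∈ G.neighborFinset x, ‖f z‖) ^ 2 := by
              gcongr
              exact norm_sum_le _ _
          _ ≤ (∑ z ∈ G.neighborFinset x, h z) * ∑ z ∈ G.neighborFinset x, ‖f z‖ ^ 2 / h z :=
              Finset.sum_sq_le_sum_mul_sum_of_sq_le_mul _ (fun z _ => (hpos z).le)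
                (fun z _ => hdiv z) fun z _ => le_of_eq <| by
                  have := (hpos z).ne'
                  field_simp
          _ ≤ _ := mul_le_mul_of_nonneg_right (hL x) (Finset.sum_nonneg fun z _ => hdiv z)
    _ = ∑' x, (∑ z ∈ G.neighborFinset x, ENNReal.ofReal (L * h z)) *
          ENNReal.ofReal (‖f x‖ ^ 2 / h x) := G.tsum_mul_sum_neighborFinset _ _
    _ ≤ ∑' x, ENNReal.ofReal (L ^ 2) * ENNReal.ofReal (‖f x‖ ^ 2) := by
        refine ENNReal.tsum_le_tsum fun x => ?_
        rw [← ENNReal.ofReal_sum_of_nonneg fun z _ => hnonneg z,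
          ← ENNReal.ofReal_mul (Finset.sum_nonneg fun z _ => hnonneg z),
          ← ENNReal.ofReal_mul (by positivity)]
        refine ENNReal.ofReal_le_ofReal ?_
        have hx := hpos x
        have hL0 : 0 ≤ L := nonneg_of_mul_nonneg_left (hnonneg x) hx
        rw [← Finset.mul_sum]
        calc L * (∑ z ∈ G.neighborFinset x, h z) * (‖f x‖ ^ 2 / h x)
            ≤ L * (L * h x) * (‖f x‖ ^ 2 / h x) := by
              gcongr
              exact hL x
          _ = L ^ 2 * ‖f x‖ ^ 2 := by field_simp
    _ = _ := ENNReal.tsum_mul_left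

theorem SimpleGraph.summable_norm_sum_neighborFinset_sq {h : V → ℝ} (hpos : ∀ x, 0 < h x) {L : ℝ}
    (hL : ∀ x, ∑ z ∈ G.neighborFinset x, h z ≤ L * h x) (f : L2 V) :
    (Summable fun x => ‖∑ z ∈ G.neighborFinset x, f z‖ ^ 2) ∧
      ∑' x, ‖∑ z ∈ G.neighborFinset x, f z‖ ^ 2 ≤ L ^ 2 * ‖f‖ ^ 2 := by
  have hf := L2.hasSum_norm_sq f
  have hle := G.tsum_norm_sum_neighborFinset_sq_le hpos hL f
  rw [← ENNReal.ofReal_tsum_of_nonneg (fun x => by positivity) hf.summable, hf.tsum_eq,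
    ← ENNReal.ofReal_mul (by positivity)] at hle
  have hsum : Summable fun x => ‖∑ z ∈ G.neighborFinset x, f z‖ ^ 2 := by
    have := ENNReal.summable_toReal (hle.trans_lt ENNReal.ofReal_lt_top).ne
    simpa [ENNReal.toReal_ofReal] using this
  rw [← ENNReal.ofReal_tsum_of_nonneg (fun x => by positivity) hsum,
    ENNReal.ofReal_le_ofReal_iff (by positivity)] at hle
  exact ⟨hsum, hle⟩

/-- Schur test for the adjacency operator of a locally finite graph. -/
theorem SimpleGraph.exists_adjacencyOp {h : V → ℝ} (hpos : ∀ x, 0 < h x) {L : ℝ} (hL0 : 0 ≤ L)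
    (hL : ∀ x, ∑ z ∈ G.neighborFinset x, h z ≤ L * h x) :
    ∃ A : L2 V →L[ℂ] L2 V, (∀ f x, A f x = ∑ z ∈ G.neighborFinset x, f z) ∧ ‖A‖ ≤ L := by
  let A₀ : L2 V →ₗ[ℂ] L2 V :=
    { toFun := fun f => ⟨fun x => ∑ z ∈ G.neighborFinset x, f z,
        memℓp_two_of_summable (G.summable_norm_sum_neighborFinset_sq hpos hL f).1⟩
      map_add' := fun f g => by
        ext x
        exact Finset.sum_add_distrib
      map_smul' := fun c f => by
        ext x
        simp [Finset.mul_sum] }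
  have hbound : ∀ f, ‖A₀ f‖ ≤ L * ‖f‖ := by
    intro f
    refine le_of_sq_le_sq ?_ (by positivity)
    rw [← (L2.hasSum_norm_sq (A₀ f)).tsum_eq, mul_pow]
    exact (G.summable_norm_sum_neighborFinset_sq hpos hL f).2
  exact ⟨A₀.mkContinuous L hbound, fun f x => rfl, A₀.mkContinuous_norm_le hL0 hbound⟩

theorem SimpleGraph.IsTree.exists_adjacencyOp (hG : G.IsTree) {m : ℕ} (hm : 1 ≤ m)
    (hreg : G.IsRegularOfDegree (m + 1)) :
    ∃ A : L2 V →L[ℂ] L2 V,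
      (∀ f x, A f x = ∑ z ∈ G.neighborFinset x, f z) ∧ ‖A‖ ≤ 2 * √m := by
  obtain ⟨y⟩ := hG.connected.nonempty
  have hm' : (1 : ℝ) ≤ m := by exact_mod_cast hm
  have hk : 0 < √(m : ℝ) := Real.sqrt_pos.2 (by linarith)
  have hk2 : √(m : ℝ) ^ 2 = m := Real.sq_sqrt (by linarith)
  refine G.exists_adjacencyOp (h := fun x => (√(m : ℝ))⁻¹ ^ G.dist y x) (fun x => by positivity)
    (by positivity) fun x => ?_
  rcases hn : G.dist y x with _ | n
  · obtain rfl := hG.connected.dist_eq_zero_iff.1 hn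
    rw [G.sum_neighborFinset_dist_self hreg y (fun n => (√(m : ℝ))⁻¹ ^ n), nsmul_eq_mul]
    push_cast
    rw [pow_one, pow_zero, mul_one, mul_inv_le_iff₀ hk]
    nlinarith
  · rw [hG.sum_neighborFinset_dist hreg hn (fun n => (√(m : ℝ))⁻¹ ^ n), nsmul_eq_mul]
    refine le_of_eq ?_
    rw [← hk2, Real.sqrt_sq hk.le]
    simp only [pow_succ]
    field_simp
    ring

theorem SimpleGraph.IsTree.exists_pow_dist (hG : G.IsTree) {m : ℕ}
    (hreg : G.IsRegularOfDegree (m + 1)) (y : V) {s : ℝ} (hs : m * s ^ 2 < 1) :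
    ∃ u : L2 V, (∀ x, u x = ((s ^ G.dist y x : ℝ) : ℂ)) ∧
      ‖u‖ ^ 2 = (1 + s ^ 2) / (1 - m * s ^ 2) := by
  have h := hG.hasSum_pow_dist hreg y (sq_nonneg s) hs
  have hcongr : (fun x => ‖((s ^ G.dist y x : ℝ) : ℂ)‖ ^ 2) = fun x => (s ^ 2) ^ G.dist y x := by
    funext x
    rw [Complex.norm_real, Real.norm_eq_abs, sq_abs, ← pow_mul, ← pow_mul, mul_comm]
  rw [← hcongr] at h
  refine ⟨⟨_, memℓp_two_of_summable h.summable⟩, fun x => rfl, ?_⟩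
  exact (L2.hasSum_norm_sq _).unique h

theorem SimpleGraph.IsTree.smul_adjacencyOp_pow_dist (hG : G.IsTree) {m : ℕ}
    (hreg : G.IsRegularOfDegree (m + 1)) {A : L2 V →L[ℂ] L2 V}
    (hA : ∀ f x, A f x = ∑ z ∈ G.neighborFinset x, f z) {y : V} {s : ℝ} {u : L2 V}
    (hu : ∀ x, u x = ((s ^ G.dist y x : ℝ) : ℂ)) :
    (s : ℂ) • A u = ((1 + m * s ^ 2 : ℝ) : ℂ) • u - ((1 - s ^ 2 : ℝ) : ℂ) • delta y := by
  ext x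
  simp only [lp.coeFn_smul, lp.coeFn_sub, Pi.smul_apply, Pi.sub_apply, smul_eq_mul, hA, hu,
    delta_apply]
  rcases hn : G.dist y x with _ | n
  · obtain rfl := hG.connected.dist_eq_zero_iff.1 hn
    rw [G.sum_neighborFinset_dist_self hreg y (fun n => ((s ^ n : ℝ) : ℂ)), nsmul_eq_mul]
    simp
    ring
  · rw [hG.sum_neighborFinset_dist hreg hn (fun n => ((s ^ n : ℝ) : ℂ)), nsmul_eq_mul, if_neg]
    · push_cast
      ring
    · rintro rfl
      simp at hn

end Tree

section Norm

variable {V : Type} {G : SimpleGraph V} [G.LocallyFinite]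

theorem SimpleGraph.IsTree.le_norm_of_mul_eq (hG : G.IsTree) {m : ℕ} (hm : 1 ≤ m)
    (hreg : G.IsRegularOfDegree (m + 1)) {A : L2 V →L[ℂ] L2 V}
    (hA : ∀ f x, A f x = ∑ z ∈ G.neighborFinset x, f z) {a : ℝ} (ha0 : 0 < a)
    {T : L2 V →L[ℂ] L2 V}
    (hT : ∀ f, T (((1 + m * a ^ 2 : ℝ) : ℂ) • f - (a : ℂ) • A f) = ((1 - a ^ 2 : ℝ) : ℂ) • f) :
    1 - a ^ 2 ≤ ‖T‖ * (1 - a * √m) ^ 2 := by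
  obtain ⟨y⟩ := hG.connected.nonempty
  have hm' : (1 : ℝ) ≤ m := by exact_mod_cast hm
  have hk : 0 < √(m : ℝ) := Real.sqrt_pos.2 (by linarith)
  have hk2 : √(m : ℝ) ^ 2 = m := Real.sq_sqrt (by linarith)
  set k := √(m : ℝ)
  have hδ : ‖delta y‖ = 1 := by
    unfold delta
    rw [lp.norm_single (by simp), norm_one]
  have hest : ∀ s ∈ Ioo 0 k⁻¹, 1 - a ^ 2 ≤
      ‖T‖ * (|1 + m * a ^ 2 - a * ((1 + m * s ^ 2) / s)| +
        a * (|1 - s ^ 2| / s) * √((1 - m * s ^ 2) / (1 + s ^ 2))) := by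
    rintro s ⟨hs0, hs1⟩
    have hsk : s * k < 1 := by rwa [lt_inv_comm₀ hs0 hk, ← one_div, lt_div_iff₀ hs0, mul_comm] at hs1
    have hms : m * s ^ 2 < 1 := by
      rw [← hk2]
      have : 0 < s * k := by positivity
      nlinarith
    obtain ⟨u, hu, hnorm⟩ := hG.exists_pow_dist hreg y hms
    have hpos : 0 < ‖u‖ := by
      refine pos_of_mul_pos_left (b := ‖u‖) ?_ (norm_nonneg u)
      rw [← sq, hnorm]
      exact div_pos (by positivity) (by linarith)
    have hinv : √((1 - m * s ^ 2) / (1 + s ^ 2)) = ‖u‖⁻¹ := by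
      rw [← inv_div, ← hnorm, Real.sqrt_inv, Real.sqrt_sq hpos.le]
    have hAu : A u = (((1 + m * s ^ 2) / s : ℝ) : ℂ) • u -
        (((1 - s ^ 2) / s : ℝ) : ℂ) • delta y := by
      have hs : (s : ℂ) ≠ 0 := by exact_mod_cast hs0.ne'
      have := congrArg (fun v => (s : ℂ)⁻¹ • v) (hG.smul_adjacencyOp_pow_dist hreg hA hu)
      simp only [inv_smul_smul₀ hs, smul_sub, smul_smul] at this
      rw [this]
      push_cast
      simp only [div_eq_inv_mul]
    have hBu : ((1 + m * a ^ 2 : ℝ) : ℂ) • u - (a : ℂ) • A u =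
        ((1 + m * a ^ 2 - a * ((1 + m * s ^ 2) / s) : ℝ) : ℂ) • u +
          ((a * ((1 - s ^ 2) / s) : ℝ) : ℂ) • delta y := by
      rw [hAu]
      push_cast
      module
    have hle : ‖((1 - a ^ 2 : ℝ) : ℂ) • u‖ ≤ ‖T‖ *
        (|1 + m * a ^ 2 - a * ((1 + m * s ^ 2) / s)| * ‖u‖ + a * (|1 - s ^ 2| / s)) := by
      rw [← hT]
      refine (T.le_opNorm _).trans (mul_le_mul_of_nonneg_left ?_ (norm_nonneg T))
      rw [hBu]
      refine (norm_add_le _ _).trans (le_of_eq ?_)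
      rw [norm_smul, norm_smul, hδ, mul_one, Complex.norm_real, Complex.norm_real,
        Real.norm_eq_abs, Real.norm_eq_abs, abs_mul a, abs_div, abs_of_pos ha0, abs_of_pos hs0]
    rw [norm_smul, Complex.norm_real, Real.norm_eq_abs] at hle
    rw [hinv]
    calc 1 - a ^ 2 ≤ |1 - a ^ 2| * ‖u‖ * ‖u‖⁻¹ := by
          rw [mul_inv_cancel_right₀ hpos.ne']
          exact le_abs_self _
      _ ≤ _ := mul_le_mul_of_nonneg_right hle (inv_nonneg.2 hpos.le)
      _ = _ := by field_simp
  have hne : k⁻¹ ≠ 0 := by positivity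
  have hcont : ContinuousAt (fun s : ℝ => ‖T‖ * (|1 + m * a ^ 2 - a * ((1 + m * s ^ 2) / s)| +
        a * (|1 - s ^ 2| / s) * √((1 - m * s ^ 2) / (1 + s ^ 2)))) k⁻¹ := by
    have hne' : (1 : ℝ) + k⁻¹ ^ 2 ≠ 0 := by positivity
    fun_prop (disch := assumption)
  have hlim := ge_of_tendsto (hcont.tendsto.mono_left nhdsWithin_le_nhds)
    (Filter.eventually_of_mem (Ioo_mem_nhdsLT (inv_pos.2 hk)) hest)
  refine hlim.trans (le_of_eq ?_)
  have hmk : (m : ℝ) * k⁻¹ ^ 2 = 1 := by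
    rw [← hk2]
    field_simp
  have hval : 1 + m * a ^ 2 - a * ((1 + m * k⁻¹ ^ 2) / k⁻¹) = (1 - a * k) ^ 2 := by
    rw [hmk, ← hk2, div_inv_eq_mul]
    ring
  rw [hval, hmk]
  simp

theorem SimpleGraph.IsTree.exists_entry_pow_dist (hG : G.IsTree) {m : ℕ} (hm : 1 ≤ m)
    (hreg : G.IsRegularOfDegree (m + 1)) {a : ℝ} (ha0 : 0 < a) (ha1 : a * √m < 1) :
    ∃ T : L2 V →L[ℂ] L2 V, (∀ x y : V, entry T x y = ((a ^ G.dist x y : ℝ) : ℂ)) ∧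
      IsSelfAdjoint T ∧ ‖T‖ = (1 - a ^ 2) / (1 - a * √m) ^ 2 := by
  obtain ⟨A, hA, hAnorm⟩ := hG.exists_adjacencyOp hm hreg
  have hm' : (1 : ℝ) ≤ m := by exact_mod_cast hm
  have hk1 : 1 ≤ √(m : ℝ) := Real.one_le_sqrt.2 hm'
  have hk2 : √(m : ℝ) ^ 2 = m := Real.sq_sqrt (by linarith)
  have hle (T : L2 V →L[ℂ] L2 V) := hG.le_norm_of_mul_eq hm hreg hA ha0 (T := T)
  have hgap : 0 < (1 - a * √m) ^ 2 := pow_pos (by linarith) 2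
  have ha2 : 0 < 1 - a ^ 2 := by nlinarith
  have hma : m * a ^ 2 < 1 := by
    rw [← hk2]
    have : 0 < a * √m := by positivity
    nlinarith
  have hcm : 1 + m * a ^ 2 - a * (2 * √m) = (1 - a * √m) ^ 2 := by
    rw [sub_sq, mul_pow, hk2]
    ring
  set k := √(m : ℝ)
  set c : ℝ := 1 + m * a ^ 2 with hc
  have hc0 : 0 < c := by positivity
  have hcC : (c : ℂ) ≠ 0 := by exact_mod_cast hc0.ne'
  have hanorm : ‖(a : ℂ) • A‖ ≤ a * (2 * k) := by
    rw [norm_smul, Complex.norm_real, Real.norm_eq_abs, abs_of_pos ha0]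
    gcongr
  have hsmall : ‖(c : ℂ)⁻¹ • ((a : ℂ) • A)‖ < 1 := by
    rw [norm_smul, norm_inv, Complex.norm_real, Real.norm_eq_abs, abs_of_pos hc0,
      inv_mul_lt_iff₀ hc0]
    linarith
  have hunit : IsUnit ((c : ℂ) • (1 : L2 V →L[ℂ] L2 V) - (a : ℂ) • A) := by
    have h := (Units.oneSub _ hsmall).isUnit.smul (Units.mk0 (c : ℂ) hcC)
    rwa [Units.val_oneSub, Units.smul_def, Units.val_mk0, smul_sub, smul_inv_smul₀ hcC] at h
  obtain ⟨B, hB⟩ := hunit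
  let T : L2 V →L[ℂ] L2 V := ((1 - a ^ 2 : ℝ) : ℂ) • (↑B⁻¹ : L2 V →L[ℂ] L2 V)
  have hBapply (f : L2 V) : (B : L2 V →L[ℂ] L2 V) f = (c : ℂ) • f - (a : ℂ) • A f := by
    rw [hB]
    rfl
  have hTB (f : L2 V) : T ((c : ℂ) • f - (a : ℂ) • A f) = ((1 - a ^ 2 : ℝ) : ℂ) • f := by
    rw [← hBapply]
    change ((1 - a ^ 2 : ℝ) : ℂ) • ((↑B⁻¹ * ↑B : L2 V →L[ℂ] L2 V) f) = _
    rw [Units.inv_mul]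
    rfl
  have hentry : ∀ x y : V, entry T x y = ((a ^ G.dist x y : ℝ) : ℂ) := by
    intro x y
    obtain ⟨u, hu, -⟩ := hG.exists_pow_dist hreg y hma
    have hTu : T (delta y) = u := by
      have h := hTB u
      rw [hG.smul_adjacencyOp_pow_dist hreg hA hu, sub_sub_cancel, map_smul] at h
      exact smul_right_injective _ (by exact_mod_cast ha2.ne') h
    rw [entry, hTu, hu, G.dist_comm]
  refine ⟨T, hentry, ?_, ?_⟩
  · rw [ContinuousLinearMap.isSelfAdjoint_iff']
    refine ext_entry fun x y => ?_
    rw [entry_adjoint, hentry, hentry, Complex.conj_ofReal, G.dist_comm]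
  · refine le_antisymm ?_ ((div_le_iff₀ hgap).2 (hle T hTB))
    refine T.opNorm_le_bound (div_nonneg ha2.le hgap.le) fun f => ?_
    obtain ⟨g, rfl⟩ : ∃ g, (B : L2 V →L[ℂ] L2 V) g = f := by
      refine ⟨(↑B⁻¹ : L2 V →L[ℂ] L2 V) f, ?_⟩
      change (↑B * ↑B⁻¹ : L2 V →L[ℂ] L2 V) f = f
      rw [Units.mul_inv]
      rfl
    have hlower : (1 - a * k) ^ 2 * ‖g‖ ≤ ‖(B : L2 V →L[ℂ] L2 V) g‖ := by
      rw [hBapply, ← hcm]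
      have h1 := norm_sub_norm_le ((c : ℂ) • g) (((a : ℂ) • A) g)
      have h2 := ((a : ℂ) • A).le_of_opNorm_le hanorm g
      rw [norm_smul, Complex.norm_real, Real.norm_eq_abs, abs_of_pos hc0] at h1
      change _ ≤ ‖(c : ℂ) • g - ((a : ℂ) • A) g‖
      linarith
    rw [hBapply, hTB, ← hBapply, norm_smul, Complex.norm_real, Real.norm_eq_abs, abs_of_pos ha2,
      div_mul_eq_mul_div, le_div_iff₀ hgap, mul_assoc]
    gcongr
    rwa [mul_comm]

end Norm

/-- **Proposition 6.1.** For `q ≥ 2` and `0 < a < 1/√(q−1)`, the matrix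
`(T_{a,q})_{xy} = a^{d(x,y)}` on the Cayley tree of degree `q` defines a bounded
self-adjoint operator on `ℓ²(V𝔾^q)` of norm `(1 − a²)/(1 − a√(q−1))²`. -/
theorem norm_of_Taq (q : ℕ) (hq : 2 ≤ q)
    {V : Type} (G : SimpleGraph V) (hG : IsCayleyTree G q)
    (a : ℝ) (ha0 : 0 < a) (ha1 : a < 1 / Real.sqrt ((q : ℝ) - 1)) :
    ∃ T : L2 V →L[ℂ] L2 V,
      (∀ x y : V, entry T x y = ((a ^ G.dist x y : ℝ) : ℂ)) ∧
      IsSelfAdjoint T ∧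
      ‖T‖ = (1 - a ^ 2) / (1 - a * Real.sqrt ((q : ℝ) - 1)) ^ 2 := by
  obtain ⟨m, rfl⟩ : ∃ m, q = m + 1 := ⟨q - 1, by omega⟩
  have hfin (v : V) : (G.neighborSet v).Finite :=
    Set.finite_of_ncard_ne_zero (by rw [hG.deg v]; omega)
  have : G.LocallyFinite := fun v => (hfin v).fintype
  have hreg : G.IsRegularOfDegree (m + 1) := fun v => by
    rw [← G.card_neighborSet_eq_degree, ← Nat.card_eq_fintype_card, Nat.card_coe_set_eq, hG.deg v]
  have hcast : ((m + 1 : ℕ) : ℝ) - 1 = m := by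
    push_cast
    ring
  rw [hcast] at ha1 ⊢
  have hm : 1 ≤ m := by omega
  have hk : 0 < √(m : ℝ) := Real.sqrt_pos.2 (by exact_mod_cast hm)
  exact SimpleGraph.IsTree.exists_entry_pow_dist ⟨hG.conn, hG.acyc⟩ hm hreg ha0
    ((lt_div_iff₀ hk).1 ha1)
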